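/- arXiv:math/0303368 — 2 statements merged into one kernel-verified Lean document; each statement's English description precedes it below -/
import Mathlib

section
/- Let $K$ be a field and let $R_1, R_2 \in K[z]$ be nonzero polynomials. Set $A = \bigl(K[z][y_1]/(y_1^2 - R_1)\bigr) \otimes_{K[z]} \bigl(K[z][y_2]/(y_2^2 - R_2)\bigr)$. Then the $K[z]$-algebra homomorphism $K[z][y]/(y^2 - R_1 R_2) \to A$ determined by $y \mapsto y_1 \otimes y_2$ is well defined and injective; in particular $A$ contains a $K[z]$-subalgebra isomorphic to $K[z][y]/(y^2 - R_1 R_2)$. -/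
open Polynomial
open scoped TensorProduct

namespace AdjoinRoot

variable {S : Type*} [CommRing S]

/-- The basis `1, y, …, y ^ (n - 1)` of `S[y] / (y ^ n - a)`. -/
noncomputable def basisXPowSubC [Nontrivial S] {n : ℕ} (hn : n ≠ 0) (a : S) :
    Module.Basis (Fin n) S (AdjoinRoot (X ^ n - C a : S[X])) :=
  (powerBasis' (monic_X_pow_sub_C a hn)).basis.reindex
    (finCongr (by rw [powerBasis'_dim, natDegree_X_pow_sub_C]))

theorem basisXPowSubC_apply [Nontrivial S] {n : ℕ} (hn : n ≠ 0) (a : S) (i : Fin n) :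
    basisXPowSubC hn a i = root (X ^ n - C a) ^ (i : ℕ) := by
  simp [basisXPowSubC]

theorem root_X_pow_sub_C_pow (n : ℕ) (a : S) :
    root (X ^ n - C a) ^ n = algebraMap S _ a := by
  have h := eval₂_root (X ^ n - C a : S[X])
  rwa [eval₂_sub, eval₂_X_pow, eval₂_C, sub_eq_zero] at h

/-- The algebra homomorphism `S[y] / (y ^ n - a * b) → S[y] / (y ^ n - a) ⊗ S[y] / (y ^ n - b)`
sending `y` to `y ⊗ y`. -/
noncomputable def rootTmulRoot (n : ℕ) (a b : S) :
    AdjoinRoot (X ^ n - C (a * b) : S[X]) →ₐ[S]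
      AdjoinRoot (X ^ n - C a : S[X]) ⊗[S] AdjoinRoot (X ^ n - C b : S[X]) :=
  liftAlgHom _ (Algebra.ofId S _) (root _ ⊗ₜ[S] root _) <| by
    rw [eval₂_sub, eval₂_X_pow, eval₂_C, Algebra.TensorProduct.tmul_pow, root_X_pow_sub_C_pow,
      root_X_pow_sub_C_pow, sub_eq_zero]
    simp only [Algebra.algebraMap_eq_smul_one, TensorProduct.smul_tmul_smul]
    exact (Algebra.algebraMap_eq_smul_one (a * b)).symm

theorem rootTmulRoot_root (n : ℕ) (a b : S) :
    rootTmulRoot n a b (root _) = root _ ⊗ₜ[S] root _ :=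
  liftAlgHom_root ..

theorem rootTmulRoot_injective [Nontrivial S] {n : ℕ} (hn : n ≠ 0) (a b : S) :
    Function.Injective (rootTmulRoot n a b) := by
  have h : LinearIndependent S ((rootTmulRoot n a b).toLinearMap ∘ basisXPowSubC hn (a * b)) := by
    have e : (rootTmulRoot n a b).toLinearMap ∘ basisXPowSubC hn (a * b) =
        (basisXPowSubC hn a).tensorProduct (basisXPowSubC hn b) ∘ fun i : Fin n ↦ (i, i) := by
      ext i
      simp [basisXPowSubC_apply, rootTmulRoot_root, Algebra.TensorProduct.tmul_pow]
    rw [e]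
    exact ((basisXPowSubC hn a).tensorProduct (basisXPowSubC hn b)).linearIndependent.comp _
      fun i j hij ↦ congrArg Prod.fst hij
  exact LinearMap.injective_of_linearIndependent (basisXPowSubC hn (a * b)).span_eq h

end AdjoinRoot

theorem stmt_5 (K : Type*) [Field K] (R₁ R₂ : Polynomial K) (h₁ : R₁ ≠ 0) (h₂ : R₂ ≠ 0) :
    ∃ f : AdjoinRoot ((X : Polynomial (Polynomial K)) ^ 2 - C (R₁ * R₂)) →ₐ[Polynomial K]
          (AdjoinRoot ((X : Polynomial (Polynomial K)) ^ 2 - C R₁) ⊗[Polynomial K]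
            AdjoinRoot ((X : Polynomial (Polynomial K)) ^ 2 - C R₂)),
      f (AdjoinRoot.root _) = AdjoinRoot.root _ ⊗ₜ[Polynomial K] AdjoinRoot.root _
      ∧ Function.Injective f
      ∧ Nonempty (AdjoinRoot ((X : Polynomial (Polynomial K)) ^ 2 - C (R₁ * R₂)) ≃ₐ[Polynomial K]
          f.range) := by
  exact ⟨AdjoinRoot.rootTmulRoot 2 R₁ R₂, AdjoinRoot.rootTmulRoot_root 2 R₁ R₂,
    AdjoinRoot.rootTmulRoot_injective two_ne_zero R₁ R₂,
    ⟨AlgEquiv.ofInjective _ (AdjoinRoot.rootTmulRoot_injective two_ne_zero R₁ R₂)⟩⟩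
end

section
/- Let $K$ be a field of characteristic different from $2$, and let $R_1, R_2 \in K[z]$ be nonconstant, squarefree, and coprime polynomials. Set $A = \bigl(K[z][y_1]/(y_1^2 - R_1)\bigr) \otimes_{K[z]} \bigl(K[z][y_2]/(y_2^2 - R_2)\bigr)$. Then $A$ is an integral domain, and $K$ is algebraically closed in the fraction field of $A$: every element of $\operatorname{Frac}(A)$ that is algebraic over $K$ lies in the image of $K$. -/
/-!
STATEMENT 6: Let `K` be a field with `char K ≠ 2`, and let `R₁, R₂ ∈ K[z]` be nonconstant,
squarefree and coprime.  With `Aᵢ = K[z][yᵢ]/(yᵢ² - Rᵢ)` (encoded as `AdjoinRoot`, which is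
by definition the quotient `K[z][y] ⧸ (y² - Rᵢ)`) and `A = A₁ ⊗_{K[z]} A₂`, the ring `A` is
an integral domain and `K` is algebraically closed in `Frac(A)`: every element of `Frac(A)`
which is algebraic over `K` (a root of the image of some nonzero polynomial over `K`) lies
in the image of `K` under the composite map `K → K[z] → A → Frac(A)`.
-/

open Polynomial
open scoped TensorProduct

/-- The affine coordinate ring `K[z][y]/(y² - R)` of the hyperelliptic curve `y² = R(z)`. -/
noncomputable abbrev hypCoordRing (K : Type*) [Field K] (R : Polynomial K) :=
  AdjoinRoot ((X : Polynomial (Polynomial K)) ^ 2 - C R)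

/-- The affine coordinate ring `A` of the fiber product `X₁ ×_{𝐏¹} X₂`. -/
noncomputable abbrev fiberProdRing (K : Type*) [Field K] (R₁ R₂ : Polynomial K) :=
  hypCoordRing K R₁ ⊗[Polynomial K] hypCoordRing K R₂

/-- The composite map `K → K[z] → A → Frac(A)`. -/
noncomputable abbrev constantsMap (K : Type*) [Field K] (R₁ R₂ : Polynomial K) :
    K →+* FractionRing (fiberProdRing K R₁ R₂) :=
  (algebraMap (fiberProdRing K R₁ R₂) (FractionRing (fiberProdRing K R₁ R₂))).comp
    ((algebraMap (Polynomial K) (fiberProdRing K R₁ R₂)).comp (C : K →+* Polynomial K))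

/-- Every element of `R[y] ⧸ (y² - r)` has the form `u + v y`. -/
theorem AdjoinRoot.exists_eq_add_mul_root_of_sq {R : Type*} [CommRing R] (r : R)
    (x : AdjoinRoot ((X : R[X]) ^ 2 - C r)) :
    ∃ u v : R, x = algebraMap R _ u + algebraMap R _ v * AdjoinRoot.root _ := by
  cases subsingleton_or_nontrivial R
  · have := (AdjoinRoot.mk_surjective (g := (X : R[X]) ^ 2 - C r)).subsingleton
    exact ⟨0, 0, Subsingleton.elim _ _⟩
  obtain ⟨p, rfl⟩ := AdjoinRoot.mk_surjective x
  have hm : ((X : R[X]) ^ 2 - C r).Monic := monic_X_pow_sub_C r two_ne_zero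
  have hd : (p %ₘ ((X : R[X]) ^ 2 - C r)).degree ≤ 1 := by
    have := degree_modByMonic_lt p hm
    rw [degree_X_pow_sub_C two_pos] at this
    exact Order.le_of_lt_succ this
  refine ⟨(p %ₘ ((X : R[X]) ^ 2 - C r)).coeff 0, (p %ₘ ((X : R[X]) ^ 2 - C r)).coeff 1, ?_⟩
  have h : AdjoinRoot.mk ((X : R[X]) ^ 2 - C r) p = AdjoinRoot.mk _ (p %ₘ (X ^ 2 - C r)) := by
    rw [AdjoinRoot.mk_eq_mk]
    exact ⟨p /ₘ (X ^ 2 - C r), by linear_combination -modByMonic_add_div p (X ^ 2 - C r)⟩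
  rw [h, eq_X_add_C_of_degree_le_one hd]
  simp [AdjoinRoot.algebraMap_eq, add_comm]

theorem AdjoinRoot.root_sq_eq {R : Type*} [CommRing R] (r : R) :
    AdjoinRoot.root ((X : R[X]) ^ 2 - C r) ^ 2 = algebraMap R _ r := by
  have := AdjoinRoot.eval₂_root ((X : R[X]) ^ 2 - C r)
  simpa [sub_eq_zero] using this

/-- If `K` is algebraically closed in `E` and `r ∈ E` is not a constant times a square, then
`K` remains algebraically closed in the quadratic extension `E(√r)`. -/
theorem exists_quadratic_extension_of_ne_const_mul_sq.{u} {K : Type*} {E : Type u} [Field K] [Field E]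
    (hK : (2 : K) ≠ 0) (i : K →+* E) (hi : ∀ x, i.IsIntegralElem x → ∃ c, x = i c)
    (r : E) (hr : ∀ (c : K) (s : E), r ≠ i c * s ^ 2) :
    ∃ (F : Type u) (_ : Field F) (j : E →+* F) (a : F), a ^ 2 = j r ∧
      (∀ u v, j u + j v * a = 0 → u = 0 ∧ v = 0) ∧
      (∀ x, ∃ u v, x = j u + j v * a) ∧
      (∀ x, (j.comp i).IsIntegralElem x → ∃ c, x = j (i c)) := by
  have hirr : Irreducible ((X : E[X]) ^ 2 - C r) :=
    X_pow_sub_C_irreducible_of_prime Nat.prime_two fun b hb => hr 1 b (by simp [hb])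
  have : Fact (Irreducible ((X : E[X]) ^ 2 - C r)) := ⟨hirr⟩
  let F := AdjoinRoot ((X : E[X]) ^ 2 - C r)
  let j : E →+* F := algebraMap E F
  let a : F := AdjoinRoot.root _
  have ha : a ^ 2 = j r := AdjoinRoot.root_sq_eq r
  have hj : Function.Injective j := j.injective
  have hform : ∀ x : F, ∃ u v, x = j u + j v * a := AdjoinRoot.exists_eq_add_mul_root_of_sq r
  refine ⟨F, inferInstance, j, a, ha, fun u v h => ?_, hform, fun x hx => ?_⟩
  · have hv : v = 0 := by
      by_contra hv
      refine hr 1 (-u / v) (hj ?_)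
      have hv' : j v ≠ 0 := by simpa using hv
      have : a = -j u / j v := by
        rw [eq_div_iff hv']
        linear_combination h
      rw [← ha, this]
      simp
    subst hv
    simpa using h
  · let σ : F →+* F := AdjoinRoot.lift j (-a) (by simp [ha])
    have hσj : ∀ u, σ (j u) = j u := fun u => AdjoinRoot.lift_of _
    have hσa : σ a = -a := AdjoinRoot.lift_root _
    obtain ⟨u, v, rfl⟩ := hform x
    have hσ : σ.comp (j.comp i) = j.comp i := by
      ext c
      simp [hσj]
    have hx' := hx.map σ
    rw [hσ, map_add, map_mul, hσj, hσj, hσa] at hx'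
    have hu : (j.comp i).IsIntegralElem (j u) := by
      have h2 : (2 : F) ≠ 0 := by
        simpa only [map_ofNat] using (map_ne_zero (j.comp i)).2 hK
      have := ((j.comp i).isIntegralElem_map (x := 2⁻¹)).mul _ (hx.add _ hx')
      have heq : (j.comp i) 2⁻¹ * (j u + j v * a + (j u + j v * -a)) = j u := by
        rw [map_inv₀, map_ofNat]
        linear_combination inv_mul_cancel₀ h2 * j u
      rwa [heq] at this
    obtain ⟨c, rfl⟩ := hi u (.of_map hj hu)
    have hva : (j.comp i).IsIntegralElem (j (v ^ 2 * r)) := by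
      have h1 := hx.sub _ hu
      have heq : (j (i c) + j v * a - j (i c)) * (j (i c) + j v * a - j (i c)) =
          j (v ^ 2 * r) := by
        rw [map_mul, map_pow, ← ha]
        ring
      exact heq ▸ h1.mul _ h1
    obtain ⟨d, hd⟩ := hi _ (.of_map hj hva)
    refine ⟨c, ?_⟩
    obtain rfl : v = 0 := by
      by_contra hv
      refine hr d v⁻¹ ?_
      rw [← hd]
      field_simp
    simp

/-- A nonconstant squarefree polynomial is not a constant times a square of a rational
function. -/
theorem Polynomial.ne_C_mul_sq_ratFunc_of_squarefree {K : Type*} [Field K] {R : K[X]}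
    (hd : 0 < R.natDegree) (hsq : Squarefree R) (c : K) (s : RatFunc K) :
    algebraMap K[X] (RatFunc K) R ≠ RatFunc.C c * s ^ 2 := by
  intro h
  have hR : R ≠ 0 := hsq.ne_zero
  have hc : c ≠ 0 := by
    rintro rfl
    simp [hR] at h
  have hs : s ^ 2 = algebraMap K[X] (RatFunc K) (C c⁻¹ * R) := by
    have : RatFunc.C c ≠ 0 := by simpa using hc
    rw [map_mul, h, RatFunc.algebraMap_C, map_inv₀]
    field_simp
  obtain ⟨p, rfl⟩ := IsIntegrallyClosed.exists_algebraMap_eq_of_isIntegral_pow (R := K[X])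
    two_pos (hs ▸ isIntegral_algebraMap)
  have hp : R = C c * p ^ 2 := by
    apply RatFunc.algebraMap_injective K
    rw [h, map_mul, map_pow, RatFunc.algebraMap_C]
  have hu : IsUnit p := hsq p ⟨C c, by rw [hp]; ring⟩
  have : IsUnit R := by
    rw [hp]
    exact (isUnit_C.2 hc.isUnit).mul (hu.pow 2)
  exact hd.ne' (natDegree_eq_zero_of_isUnit this)

theorem RatFunc.exists_eq_C_of_isIntegralElem {K : Type*} [Field K] (x : RatFunc K)
    (hx : (RatFunc.C : K →+* RatFunc K).IsIntegralElem x) : ∃ c, x = RatFunc.C c := by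
  by_contra h
  refine RatFunc.transcendental_of_ne_C x h ?_
  have : IsIntegral K x := by
    rw [← RatFunc.algebraMap_eq_C] at hx
    exact hx
  exact this.isAlgebraic

/-- A model of the field `K(z)(√R₁, √R₂)`. -/
theorem exists_biquadratic_extension.{u} {K : Type u} [Field K] (hK : (2 : K) ≠ 0) {R₁ R₂ : K[X]}
    (hd₁ : 0 < R₁.natDegree) (hd₂ : 0 < R₂.natDegree)
    (hsq₁ : Squarefree R₁) (hsq₂ : Squarefree R₂) (hco : IsCoprime R₁ R₂) :
    ∃ (F : Type u) (_ : Field F) (j : K[X] →+* F) (a b : F), a ^ 2 = j R₁ ∧ b ^ 2 = j R₂ ∧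
      (∀ u v w t, j u + j v * a + (j w + j t * a) * b = 0 → u = 0 ∧ v = 0 ∧ w = 0 ∧ t = 0) ∧
      (∀ x, (j.comp C).IsIntegralElem x → ∃ c, x = j (C c)) := by
  have hinj := RatFunc.algebraMap_injective K
  obtain ⟨E, _, j, a, ha, hlin, hform, hint⟩ :=
    exists_quadratic_extension_of_ne_const_mul_sq hK RatFunc.C
      RatFunc.exists_eq_C_of_isIntegralElem (algebraMap K[X] _ R₁)
      (ne_C_mul_sq_ratFunc_of_squarefree hd₁ hsq₁)
  have h2 : (2 : RatFunc K) ≠ 0 := by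
    simpa only [map_ofNat] using (map_ne_zero (RatFunc.C : K →+* RatFunc K)).2 hK
  have hR₂ : ∀ (c : K) (s : E), j (algebraMap K[X] _ R₂) ≠ (j.comp RatFunc.C) c * s ^ 2 := by
    intro c s h
    obtain ⟨p, q, rfl⟩ := hform s
    have hc : RatFunc.C c ≠ 0 := by
      intro hc
      have : algebraMap K[X] (RatFunc K) R₂ = 0 := by
        apply j.injective
        simp [h, hc]
      exact hsq₂.ne_zero (hinj (by simpa using this))
    obtain ⟨h₀, h₁⟩ := hlin
      (RatFunc.C c * (p ^ 2 + q ^ 2 * algebraMap K[X] _ R₁) - algebraMap K[X] _ R₂)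
      (RatFunc.C c * (2 * (p * q))) (by
        simp only [map_sub, map_mul, map_add, map_pow, ← ha, h, RingHom.comp_apply, map_ofNat]
        ring)
    have hpq : p = 0 ∨ q = 0 := by simpa [hc, h2] using h₁
    rcases hpq with rfl | rfl
    · refine ne_C_mul_sq_ratFunc_of_squarefree (R := R₁ * R₂) ?_ ?_ c
        (q * algebraMap K[X] _ R₁) ?_
      · rw [natDegree_mul hsq₁.ne_zero hsq₂.ne_zero]
        omega
      · exact squarefree_mul_iff.2 ⟨hco.isRelPrime, hsq₁, hsq₂⟩
      · rw [map_mul]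
        linear_combination -algebraMap K[X] (RatFunc K) R₁ * h₀
    · exact ne_C_mul_sq_ratFunc_of_squarefree hd₂ hsq₂ c p (by linear_combination -h₀)
  obtain ⟨F, _, l, b, hb, hlin', -, hint'⟩ :=
    exists_quadratic_extension_of_ne_const_mul_sq hK (j.comp RatFunc.C) hint
      (j (algebraMap K[X] _ R₂)) hR₂
  refine ⟨F, inferInstance, l.comp (j.comp (algebraMap K[X] _)), l a, b, ?_, hb, ?_, ?_⟩
  · simp [← map_pow, ha]
  · intro u v w t h
    obtain ⟨h₀, h₁⟩ := hlin' (j (algebraMap K[X] _ u) + j (algebraMap K[X] _ v) * a)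
      (j (algebraMap K[X] _ w) + j (algebraMap K[X] _ t) * a) (by simpa using h)
    obtain ⟨hu, hv⟩ := hlin _ _ h₀
    obtain ⟨hw, ht⟩ := hlin _ _ h₁
    exact ⟨hinj (by simpa using hu), hinj (by simpa using hv), hinj (by simpa using hw),
      hinj (by simpa using ht)⟩
  · intro x hx
    have hC : (l.comp (j.comp (algebraMap K[X] (RatFunc K)))).comp C =
        l.comp (j.comp RatFunc.C) := by
      ext c
      simp
    rw [hC] at hx
    obtain ⟨c, rfl⟩ := hint' x hx
    exact ⟨c, by simp⟩

/-- Every element of the fiber product ring has the form `u + v y₁ + w y₂ + t y₁ y₂`. -/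
theorem fiberProdRing_exists_eq {K : Type*} [Field K] {R₁ R₂ : K[X]}
    (x : fiberProdRing K R₁ R₂) :
    ∃ u v w t : K[X], x =
      algebraMap K[X] (fiberProdRing K R₁ R₂) u +
        algebraMap K[X] (fiberProdRing K R₁ R₂) v * (AdjoinRoot.root _ ⊗ₜ 1) +
      (algebraMap K[X] (fiberProdRing K R₁ R₂) w +
        algebraMap K[X] (fiberProdRing K R₁ R₂) t * (AdjoinRoot.root _ ⊗ₜ 1)) *
          (1 ⊗ₜ AdjoinRoot.root _) := by
  induction x using TensorProduct.induction_on with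
  | zero => exact ⟨0, 0, 0, 0, by simp⟩
  | tmul x y =>
    obtain ⟨u, v, rfl⟩ := AdjoinRoot.exists_eq_add_mul_root_of_sq R₁ x
    obtain ⟨w, t, rfl⟩ := AdjoinRoot.exists_eq_add_mul_root_of_sq R₂ y
    refine ⟨u * w, v * w, u * t, v * t, ?_⟩
    let l : hypCoordRing K R₁ →ₐ[K[X]] fiberProdRing K R₁ R₂ :=
      Algebra.TensorProduct.includeLeft
    let m : hypCoordRing K R₂ →ₐ[K[X]] fiberProdRing K R₁ R₂ :=
      Algebra.TensorProduct.includeRight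
    have hlm : ∀ x y, x ⊗ₜ y = l x * m y := fun x y => by simp [l, m]
    simp only [hlm, map_add, map_mul, map_one, AlgHom.commutes]
    ring
  | add x y hx hy =>
    obtain ⟨u, v, w, t, rfl⟩ := hx
    obtain ⟨u', v', w', t', rfl⟩ := hy
    refine ⟨u + u', v + v', w + w', t + t', ?_⟩
    simp only [map_add]
    ring

theorem stmt_6 (K : Type*) [Field K] (hK : (2 : K) ≠ 0) (R₁ R₂ : Polynomial K)
    (hd₁ : 0 < R₁.natDegree) (hd₂ : 0 < R₂.natDegree)
    (hsq₁ : Squarefree R₁) (hsq₂ : Squarefree R₂) (hco : IsCoprime R₁ R₂) :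
    IsDomain (fiberProdRing K R₁ R₂) ∧
    ∀ x : FractionRing (fiberProdRing K R₁ R₂),
      (∃ p : Polynomial K, p ≠ 0 ∧ (p.map (constantsMap K R₁ R₂)).eval x = 0) →
      x ∈ Set.range (constantsMap K R₁ R₂) := by
  obtain ⟨F, _, j, a, b, ha, hb, hlin, hint⟩ :=
    exists_biquadratic_extension hK hd₁ hd₂ hsq₁ hsq₂ hco
  let : Algebra K[X] F := j.toAlgebra
  let f₁ : hypCoordRing K R₁ →ₐ[K[X]] F :=
    AdjoinRoot.liftAlgHom _ (Algebra.ofId K[X] F) a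
      (by simp [ha, RingHom.algebraMap_toAlgebra])
  let f₂ : hypCoordRing K R₂ →ₐ[K[X]] F :=
    AdjoinRoot.liftAlgHom _ (Algebra.ofId K[X] F) b
      (by simp [hb, RingHom.algebraMap_toAlgebra])
  let φ : fiberProdRing K R₁ R₂ →ₐ[K[X]] F := Algebra.TensorProduct.productMap f₁ f₂
  have hφj : ∀ u, φ (algebraMap K[X] _ u) = j u := φ.commutes
  have hφa : φ (AdjoinRoot.root _ ⊗ₜ 1) = a := by simp [φ, f₁]
  have hφb : φ (1 ⊗ₜ AdjoinRoot.root _) = b := by simp [φ, f₂]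
  have hφ : Function.Injective φ := by
    rw [injective_iff_map_eq_zero]
    intro x hx
    obtain ⟨u, v, w, t, rfl⟩ := fiberProdRing_exists_eq x
    simp only [map_add, map_mul, hφj, hφa, hφb] at hx
    obtain ⟨rfl, rfl, rfl, rfl⟩ := hlin u v w t hx
    simp
  have hdom : IsDomain (fiberProdRing K R₁ R₂) := hφ.isDomain φ.toRingHom
  refine ⟨hdom, fun x ⟨p, hp, hpx⟩ => ?_⟩
  let ψ : FractionRing (fiberProdRing K R₁ R₂) →+* F :=
    IsFractionRing.lift (g := φ.toRingHom) hφ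
  have hψ : ∀ y, ψ (algebraMap _ _ y) = φ y := fun y => IsFractionRing.lift_algebraMap hφ y
  have hcomp : ψ.comp (constantsMap K R₁ R₂) = j.comp C := by
    ext c
    simp only [RingHom.comp_apply, hψ, hφj]
  have hx : (j.comp C).IsIntegralElem (ψ x) := by
    refine ⟨p * C p.leadingCoeff⁻¹, monic_mul_leadingCoeff_inv hp, ?_⟩
    rw [eval_map] at hpx
    rw [eval₂_mul, ← hcomp, ← hom_eval₂, hpx, map_zero, zero_mul]
  obtain ⟨c, hc⟩ := hint _ hx
  refine ⟨c, ψ.injective ?_⟩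
  rw [hc, ← RingHom.comp_apply, hcomp, RingHom.comp_apply]
end
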